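/- For |q|<1, the product (q²;q²)_∞/(q;q²)_∞ equals ∑_{n=0}^∞ q^{n(n+1)/2}, i.e. (1/2)·∑_{n∈ℤ} q^{n(n+1)/2}. -/

import Mathlib

open Filter Topology Finset

theorem one_sub_pow_ne_zero_of_norm_lt_one {q : ℂ} (hq : ‖q‖ < 1) {k : ℕ} (hk : k ≠ 0) :
    1 - q ^ k ≠ 0 := by
  intro h
  have h1 : ‖q ^ k‖ < 1 := by
    rw [norm_pow]
    exact pow_lt_one₀ (norm_nonneg _) hq hk
  rw [← sub_eq_zero.mp h] at h1
  simp at h1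

/-- The partial products of `(q²;q²)_∞ / (q;q²)_∞`. -/
noncomputable def gaussPartialProd (q : ℂ) (n : ℕ) : ℂ :=
  (∏ j ∈ range n, (1 - q ^ (2 * j + 2))) / ∏ j ∈ range n, (1 - q ^ (2 * j + 1))

theorem gaussPartialProd_zero (q : ℂ) : gaussPartialProd q 0 = 1 := by
  simp [gaussPartialProd]

theorem gaussPartialProd_succ (q : ℂ) (n : ℕ) :
    gaussPartialProd q (n + 1) =
      gaussPartialProd q n * ((1 - q ^ (2 * n + 2)) / (1 - q ^ (2 * n + 1))) := by
  simp only [gaussPartialProd, prod_range_succ]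
  exact mul_div_mul_comm _ _ _ _

theorem gaussPartialProd_ne_zero {q : ℂ} (hq : ‖q‖ < 1) (n : ℕ) : gaussPartialProd q n ≠ 0 :=
  div_ne_zero
    (prod_ne_zero_iff.mpr fun _ _ => one_sub_pow_ne_zero_of_norm_lt_one hq (by omega))
    (prod_ne_zero_iff.mpr fun _ _ => one_sub_pow_ne_zero_of_norm_lt_one hq (by omega))

theorem sum_gaussPartialProd_succ_sub {q : ℂ} (hq : ‖q‖ < 1) (n m : ℕ) :
    ∑ s ∈ range m, (gaussPartialProd q (n + 1) / gaussPartialProd q s * q ^ (s * (2 * n + 3)) -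
        gaussPartialProd q n / gaussPartialProd q s * q ^ (s * (2 * n + 1))) =
      gaussPartialProd q n / (1 - q ^ (2 * n + 1)) *
        (q ^ (m * (2 * n + 1)) * (1 - q ^ (2 * m)) / gaussPartialProd q m) := by
  induction m with
  | zero => simp
  | succ m ih =>
    have h1 := one_sub_pow_ne_zero_of_norm_lt_one hq (k := 2 * n + 1) (by omega)
    have h2 := one_sub_pow_ne_zero_of_norm_lt_one hq (k := 2 * m + 1) (by omega)
    have h3 := one_sub_pow_ne_zero_of_norm_lt_one hq (k := 2 * m + 2) (by omega)
    have h4 := gaussPartialProd_ne_zero hq m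
    rw [sum_range_succ, ih, gaussPartialProd_succ, gaussPartialProd_succ,
      show 2 * (m + 1) = 2 * m + 2 by ring]
    field_simp
    ring

/-- Shanks' finite form of Gauss's identity. -/
theorem sum_gaussPartialProd_div {q : ℂ} (hq : ‖q‖ < 1) (n : ℕ) :
    ∑ s ∈ range (n + 1), gaussPartialProd q n / gaussPartialProd q s * q ^ (s * (2 * n + 1)) =
      ∑ t ∈ range (2 * n + 1), q ^ (t * (t + 1) / 2) := by
  induction n with
  | zero => simp [gaussPartialProd_zero]
  | succ n ih =>
    have key := sum_gaussPartialProd_succ_sub hq n (n + 1)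
    have h1 := one_sub_pow_ne_zero_of_norm_lt_one hq (k := 2 * n + 1) (by omega)
    have h3 := one_sub_pow_ne_zero_of_norm_lt_one hq (k := 2 * n + 2) (by omega)
    have h4 := gaussPartialProd_ne_zero hq n
    have hr : gaussPartialProd q n / (1 - q ^ (2 * n + 1)) *
        (q ^ ((n + 1) * (2 * n + 1)) * (1 - q ^ (2 * (n + 1))) / gaussPartialProd q (n + 1)) =
        q ^ ((n + 1) * (2 * n + 1)) := by
      rw [gaussPartialProd_succ, show 2 * (n + 1) = 2 * n + 2 by ring]
      field_simp
    rw [sum_sub_distrib, ih, hr, sub_eq_iff_eq_add] at key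
    have e1 : (2 * n + 1) * (2 * n + 1 + 1) / 2 = (n + 1) * (2 * n + 1) :=
      Nat.div_eq_of_eq_mul_left two_pos (by ring)
    have e2 : (2 * n + 1 + 1) * (2 * n + 1 + 1 + 1) / 2 = (n + 1) * (2 * n + 3) :=
      Nat.div_eq_of_eq_mul_left two_pos (by ring)
    rw [sum_range_succ, div_self (gaussPartialProd_ne_zero hq _), one_mul,
      show 2 * (n + 1) + 1 = 2 * n + 1 + 1 + 1 by ring, sum_range_succ _ (2 * n + 1 + 1),
      sum_range_succ _ (2 * n + 1), e1, e2, show 2 * n + 1 + 1 + 1 = 2 * n + 3 by ring, key]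
    ring

theorem summable_norm_neg_pow_comp {q : ℂ} (hq : ‖q‖ < 1) {f : ℕ → ℕ} (hf : ∀ n, n ≤ f n) :
    Summable fun n => ‖-q ^ f n‖ := by
  refine (summable_geometric_of_lt_one (norm_nonneg q) hq).of_nonneg_of_le
    (fun _ => norm_nonneg _) fun n => ?_
  rw [norm_neg, norm_pow]
  exact pow_le_pow_of_le_one (norm_nonneg q) hq.le (hf n)

theorem tendsto_prod_one_sub_pow {q : ℂ} (hq : ‖q‖ < 1) {f : ℕ → ℕ} (hf : ∀ n, n ≤ f n) :
    Tendsto (fun n => ∏ j ∈ range n, (1 - q ^ f j)) atTop (𝓝 (∏' j, (1 - q ^ f j))) := by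
  have h := multipliable_one_add_of_summable (summable_norm_neg_pow_comp hq hf)
  simp only [← sub_eq_add_neg] at h
  exact h.hasProd.tendsto_prod_nat

theorem tprod_one_sub_pow_ne_zero {q : ℂ} (hq : ‖q‖ < 1) {f : ℕ → ℕ} (hf : ∀ n, n < f n) :
    ∏' j, (1 - q ^ f j) ≠ 0 := by
  simp only [sub_eq_add_neg]
  refine tprod_one_add_ne_zero_of_summable (fun n => ?_)
    (summable_norm_neg_pow_comp hq fun n => (hf n).le)
  rw [← sub_eq_add_neg]
  exact one_sub_pow_ne_zero_of_norm_lt_one hq (Nat.ne_zero_of_lt (hf n))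

theorem tendsto_gaussPartialProd {q : ℂ} (hq : ‖q‖ < 1) :
    Tendsto (gaussPartialProd q) atTop
      (𝓝 ((∏' j : ℕ, (1 - q ^ (2 * j + 2))) / ∏' j : ℕ, (1 - q ^ (2 * j + 1)))) :=
  (tendsto_prod_one_sub_pow hq fun n => by omega).div
    (tendsto_prod_one_sub_pow hq fun n => by omega)
    (tprod_one_sub_pow_ne_zero hq fun n => by omega)

theorem exists_norm_gaussPartialProd_div_le {q : ℂ} (hq : ‖q‖ < 1) :
    ∃ C, ∀ n s, ‖gaussPartialProd q n / gaussPartialProd q s‖ ≤ C := by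
  have h := tendsto_gaussPartialProd hq
  have h' := h.inv₀ (div_ne_zero (tprod_one_sub_pow_ne_zero hq fun n => by omega)
    (tprod_one_sub_pow_ne_zero hq fun n => by omega))
  obtain ⟨A, hA⟩ := (Metric.isBounded_range_of_tendsto _ h).exists_norm_le
  obtain ⟨B, hB⟩ := (Metric.isBounded_range_of_tendsto _ h').exists_norm_le
  refine ⟨A * B, fun n s => ?_⟩
  have hn := hA _ ⟨n, rfl⟩
  rw [div_eq_mul_inv, norm_mul]
  exact mul_le_mul hn (hB _ ⟨s, rfl⟩) (norm_nonneg _) ((norm_nonneg _).trans hn)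

theorem tendsto_sum_gaussPartialProd_div_tail {q : ℂ} (hq : ‖q‖ < 1) :
    Tendsto (fun n => ∑ s ∈ range n, gaussPartialProd q n / gaussPartialProd q (s + 1) *
      q ^ ((s + 1) * (2 * n + 1))) atTop (𝓝 0) := by
  obtain ⟨C, hC⟩ := exists_norm_gaussPartialProd_div_le hq
  have hlim : Tendsto (fun n : ℕ => C * (n * ‖q‖ ^ n)) atTop (𝓝 0) := by
    simpa using (tendsto_self_mul_const_pow_of_lt_one (norm_nonneg q) hq).const_mul C
  refine squeeze_zero_norm (fun n => ?_) hlim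
  calc _ ≤ ∑ s ∈ range n, C * ‖q‖ ^ n := by
        refine norm_sum_le_of_le _ fun s _ => ?_
        rw [norm_mul, norm_pow]
        refine mul_le_mul (hC _ _) (pow_le_pow_of_le_one (norm_nonneg q) hq.le (by nlinarith))
          (by positivity) ((norm_nonneg _).trans (hC 0 0))
    _ = C * (n * ‖q‖ ^ n) := by
        rw [sum_const, card_range, nsmul_eq_mul]
        ring

theorem summable_pow_triangular {q : ℂ} (hq : ‖q‖ < 1) :
    Summable fun n : ℕ => q ^ (n * (n + 1) / 2) := by
  have hf : ∀ n : ℕ, n ≤ n * (n + 1) / 2 := fun n => by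
    rw [Nat.le_div_iff_mul_le two_pos]
    rcases n with _ | n
    · simp
    · nlinarith
  refine Summable.of_norm ?_
  simpa only [norm_neg] using summable_norm_neg_pow_comp hq hf

/-- Gauss's identity for triangular numbers: for `‖q‖ < 1`,
`(q²;q²)_∞/(q;q²)_∞ = ∑_{n=0}^∞ q^{n(n+1)/2}`. -/
theorem gauss_triangular_identity (q : ℂ) (hq : ‖q‖ < 1) :
    (∏' j : ℕ, (1 - q ^ (2 * j + 2))) / (∏' j : ℕ, (1 - q ^ (2 * j + 1))) =
      ∑' n : ℕ, q ^ (n * (n + 1) / 2) := by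
  have hprod := (tendsto_sum_gaussPartialProd_div_tail hq).add (tendsto_gaussPartialProd hq)
  rw [zero_add] at hprod
  have hodd : Tendsto (fun n : ℕ => 2 * n + 1) atTop atTop :=
    tendsto_atTop_mono (fun n => (by omega : n ≤ 2 * n + 1)) tendsto_id
  refine tendsto_nhds_unique hprod
    (((summable_pow_triangular hq).hasSum.tendsto_sum_nat.comp hodd).congr fun n => ?_)
  rw [Function.comp_apply, ← sum_gaussPartialProd_div hq, sum_range_succ']
  simp [gaussPartialProd_zero]
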